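/- Let f : ℝ^d → [0,∞) be measurable and integrable, let L > 0, let Λ be the cube of side L in ℝ^d with volume |Λ| = L^d, and define f_Λ(x) = ∑_{z∈ℤ^d} f(x − Lz). Then for every integer j ≥ 1, with the convention y_{j+1} := y_1, ∫_{Λ^j} ∏_{i=1}^j f_Λ(y_i − y_{i+1}) dy_1 … dy_j = |Λ| ∑_{z∈ℤ^d} f^{*j}(Lz), where f^{*j} denotes the j-fold convolution of f with itself. -/

import Mathlib

open MeasureTheory Filter Topology ENNReal

noncomputable section

/-- Euclidean space `ℝ^d`. -/
abbrev Eu (d : ℕ) := EuclideanSpace ℝ (Fin d)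

/-- The lattice point `Lz ∈ ℝ^d`, for `z ∈ ℤ^d`. -/
def latPt (d : ℕ) (L : ℝ) (z : Fin d → ℤ) : Eu d :=
  (WithLp.equiv 2 (Fin d → ℝ)).symm (fun i => L * (z i))

/-- The cube `Λ ⊆ ℝ^d` of side `L`. -/
def cube (d : ℕ) (L : ℝ) : Set (Eu d) := {x | ∀ i, x i ∈ Set.Ico (0:ℝ) L}

/-- The periodization `f_Λ(x) = ∑_{z∈ℤ^d} f(x - Lz)`, with values in `[0,∞]`. -/
def fper (d : ℕ) (f : Eu d → ℝ) (L : ℝ) (x : Eu d) : ℝ≥0∞ :=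
  ∑' z : Fin d → ℤ, ENNReal.ofReal (f (x - latPt d L z))

/-- Iterated self-convolution (values in `[0,∞]`): `iterConv d F n = F^{*(n+1)}`,
i.e. `iterConv d F 0 = F` and `iterConv d F (n+1) = (iterConv d F n) * F`
(convolution `(F*G)(x) = ∫ F(x-y) G(y) dy`). -/
def iterConv (d : ℕ) (F : Eu d → ℝ≥0∞) : ℕ → Eu d → ℝ≥0∞
  | 0 => F
  | n + 1 => fun x => ∫⁻ y : Eu d, iterConv d F n (x - y) * F y
/-- The periodization of an `[0,∞]`-valued function over the lattice `Lℤ^d`. -/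
def periodization (d : ℕ) (L : ℝ) (F : Eu d → ℝ≥0∞) (x : Eu d) : ℝ≥0∞ :=
  ∑' z : Fin d → ℤ, F (x - latPt d L z)

@[simp]
lemma latPt_apply (d : ℕ) (L : ℝ) (z : Fin d → ℤ) (i : Fin d) : latPt d L z i = L * z i := rfl

lemma latPt_add (d : ℕ) (L : ℝ) (z w : Fin d → ℤ) :
    latPt d L (z + w) = latPt d L z + latPt d L w := by
  ext i
  simp [mul_add]

lemma latPt_neg (d : ℕ) (L : ℝ) (z : Fin d → ℤ) : latPt d L (-z) = -latPt d L z := by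
  ext i
  simp

lemma measurable_periodization {d : ℕ} (L : ℝ) {F : Eu d → ℝ≥0∞} (hF : Measurable F) :
    Measurable (periodization d L F) :=
  Measurable.tsum fun z => hF.comp (measurable_id.sub_const (latPt d L z))

lemma periodization_add_latPt {d : ℕ} (L : ℝ) (F : Eu d → ℝ≥0∞) (x : Eu d) (w : Fin d → ℤ) :
    periodization d L F (x + latPt d L w) = periodization d L F x := by
  unfold periodization
  rw [← (Equiv.addRight w).tsum_eq]
  refine tsum_congr fun z => ?_
  rw [Equiv.coe_addRight, latPt_add, add_sub_add_right_eq_sub]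

lemma periodization_zero {d : ℕ} (L : ℝ) (F : Eu d → ℝ≥0∞) :
    periodization d L F 0 = ∑' z : Fin d → ℤ, F (latPt d L z) := by
  unfold periodization
  rw [← (Equiv.neg (Fin d → ℤ)).tsum_eq]
  refine tsum_congr fun z => ?_
  rw [Equiv.neg_apply, latPt_neg, zero_sub, neg_neg]

lemma measurable_iterConv {d : ℕ} {F : Eu d → ℝ≥0∞} (hF : Measurable F) (n : ℕ) :
    Measurable (iterConv d F n) := by
  induction n with
  | zero => exact hF
  | succ n ih =>
    refine Measurable.lintegral_prod_right' (f := fun p : Eu d × Eu d =>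
      iterConv d F n (p.1 - p.2) * F p.2) ?_
    exact (ih.comp (measurable_fst.sub measurable_snd)).mul (hF.comp measurable_snd)

lemma cube_eq_preimage (d : ℕ) (L : ℝ) :
    cube d L = WithLp.ofLp ⁻¹' (Set.univ.pi fun _ : Fin d => Set.Ico (0 : ℝ) L) := by
  ext x
  simp [cube]

lemma measurableSet_cube (d : ℕ) (L : ℝ) : MeasurableSet (cube d L) := by
  rw [cube_eq_preimage]
  exact (PiLp.volume_preserving_ofLp (Fin d)).measurable
    (MeasurableSet.univ_pi fun _ => measurableSet_Ico)

lemma volume_cube (d : ℕ) {L : ℝ} (hL : 0 < L) : volume (cube d L) = ENNReal.ofReal (L ^ d) := by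
  rw [cube_eq_preimage, (PiLp.volume_preserving_ofLp (Fin d)).measure_preimage
    (MeasurableSet.univ_pi fun _ => measurableSet_Ico).nullMeasurableSet, Real.volume_pi_Ico]
  simp [ENNReal.ofReal_pow hL.le]

lemma add_latPt_mem_cube_iff {d : ℕ} {L : ℝ} (hL : 0 < L) (x : Eu d) (z : Fin d → ℤ) :
    x + latPt d L z ∈ cube d L ↔ z = fun i => -⌊x i / L⌋ := by
  rw [funext_iff]
  refine forall_congr' fun i => ?_
  rw [eq_comm, neg_eq_iff_eq_neg, Int.floor_eq_iff, le_div_iff₀ hL, div_lt_iff₀ hL, Set.mem_Ico]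
  simp only [PiLp.add_apply, latPt_apply, Int.cast_neg]
  constructor <;> rintro ⟨h₁, h₂⟩ <;> constructor <;> linarith

/-- Unfolding: integrating a periodization over the cube is integrating over the whole space. -/
lemma lintegral_cube_periodization {d : ℕ} {L : ℝ} (hL : 0 < L) {H : Eu d → ℝ≥0∞}
    (hH : Measurable H) : ∫⁻ y in cube d L, periodization d L H y = ∫⁻ y, H y := by
  unfold periodization
  rw [lintegral_tsum fun z => by fun_prop]
  have translate (z : Fin d → ℤ) : ∫⁻ y in cube d L, H (y - latPt d L z) =
      ∫⁻ y, (cube d L).indicator (fun _ => H y) (y + latPt d L z) := by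
    rw [← lintegral_indicator (measurableSet_cube d L),
      ← lintegral_add_right_eq_self _ (latPt d L z)]
    simp only [Set.indicator, add_sub_cancel_right]
  simp_rw [translate]
  rw [← lintegral_tsum]
  · refine lintegral_congr fun y => ?_
    rw [tsum_eq_single (fun i => -⌊y i / L⌋)]
    · exact Set.indicator_of_mem ((add_latPt_mem_cube_iff hL y _).2 rfl) _
    · exact fun z hz => Set.indicator_of_notMem (mt (add_latPt_mem_cube_iff hL y z).1 hz) _
  · intro z
    exact (Measurable.ite ((measurable_id.add_const (latPt d L z)) (measurableSet_cube d L))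
      hH measurable_const).aemeasurable

lemma lintegral_cube_periodization_mul {d : ℕ} {L : ℝ} (hL : 0 < L) {A B : Eu d → ℝ≥0∞}
    (hA : Measurable A) (hB : Measurable B) (x w : Eu d) :
    ∫⁻ y in cube d L, periodization d L A (x - y) * periodization d L B (y - w) =
      periodization d L (fun u => ∫⁻ y, A (u - y) * B y) (x - w) := by
  have hPA := measurable_periodization L hA
  calc
    _ = ∫⁻ y in cube d L,
          periodization d L (fun y => periodization d L A (x - y) * B (y - w)) y := by
      refine lintegral_congr fun y => ?_
      rw [periodization.eq_1 d L B, ← ENNReal.tsum_mul_left]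
      refine tsum_congr fun z => ?_
      dsimp only
      rw [sub_sub_eq_add_sub x y, add_sub_right_comm, periodization_add_latPt, sub_right_comm]
    _ = ∫⁻ y, periodization d L A (x - y) * B (y - w) :=
      lintegral_cube_periodization hL ((hPA.comp (measurable_id.const_sub x)).mul
        (hB.comp (measurable_id.sub_const w)))
    _ = ∫⁻ y, periodization d L A (x - w - y) * B y := by
      rw [← lintegral_add_right_eq_self _ w]
      simp only [add_sub_cancel_right, sub_add_eq_sub_sub_swap]
    _ = _ := by
      simp only [periodization, ← ENNReal.tsum_mul_right]
      rw [lintegral_tsum fun z => by fun_prop]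
      simp only [sub_right_comm _ _ (latPt d L _)]

lemma lintegral_pi_insertNth {α : Type*} [MeasurableSpace α] (ν : Measure α) [SigmaFinite ν]
    {n : ℕ} (p : Fin (n + 1)) {Φ : (Fin (n + 1) → α) → ℝ≥0∞} (hΦ : Measurable Φ) :
    ∫⁻ y, Φ y ∂(Measure.pi fun _ => ν) =
      ∫⁻ t, ∫⁻ y, Φ (p.insertNth t y) ∂(Measure.pi fun _ => ν) ∂ν := by
  have hp := (measurePreserving_piFinSuccAbove (fun _ : Fin (n + 1) => ν) p).symm
  rw [← hp.lintegral_comp hΦ]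
  exact lintegral_prod _ (hΦ.comp hp.measurable).aemeasurable

lemma measurable_prod_cons_sub_snoc {d n : ℕ} {G : Eu d → ℝ≥0∞} (hG : Measurable G)
    (a b : Eu d) :
    Measurable fun y : Fin n → Eu d =>
      ∏ i, G ((Fin.cons a y : Fin (n + 1) → Eu d) i - (Fin.snoc y b : Fin (n + 1) → Eu d) i) := by
  refine Finset.measurable_prod _ fun i _ => hG.comp (Measurable.sub ?_ ?_)
  · induction i using Fin.cases with
    | zero => simp
    | succ i => simpa using by fun_prop
  · induction i using Fin.lastCases with
    | last => simp
    | cast i => simpa using by fun_prop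

/-- Integrating out the interior vertices of a path from `a` to `b`. -/
lemma lintegral_path_periodization {d : ℕ} {L : ℝ} (hL : 0 < L) {F : Eu d → ℝ≥0∞}
    (hF : Measurable F) (n : ℕ) (a b : Eu d) :
    ∫⁻ y, ∏ i, periodization d L F ((Fin.cons a y : Fin (n + 1) → Eu d) i -
        (Fin.snoc y b : Fin (n + 1) → Eu d) i)
        ∂(Measure.pi fun _ => volume.restrict (cube d L)) =
      periodization d L (iterConv d F n) (a - b) := by
  have hP := measurable_periodization L hF
  induction n generalizing b with
  | zero =>
    rw [Measure.pi_of_empty, lintegral_dirac]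
    simp [Fin.snoc, iterConv]
  | succ n ih =>
    rw [lintegral_pi_insertNth _ (Fin.last n) (measurable_prod_cons_sub_snoc hP a b)]
    simp only [Fin.insertNth_last', Fin.prod_univ_castSucc (n := n + 1),
      Fin.cons_snoc_eq_snoc_cons, Fin.snoc_castSucc, Fin.snoc_last]
    simp only [iterConv, ← lintegral_cube_periodization_mul hL (measurable_iterConv hF n) hF]
    refine lintegral_congr fun t => ?_
    rw [lintegral_mul_const _ (measurable_prod_cons_sub_snoc hP a t), ih]

lemma cons_finRotate {α : Type*} {n : ℕ} (a : α) (y : Fin n → α) (i : Fin (n + 1)) :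
    (Fin.cons a y : Fin (n + 1) → α) (finRotate (n + 1) i) =
      (Fin.snoc y a : Fin (n + 1) → α) i := by
  induction i using Fin.lastCases with
  | last => simp
  | cast i => rw [finRotate_apply, Fin.coeSucc_eq_succ, Fin.cons_succ, Fin.snoc_castSucc]

/-- Eq. (3.3): for `f : ℝ^d → [0,∞)` measurable and integrable, `L > 0`,
`Λ` the cube of side `L`, `f_Λ(x) = ∑_{z∈ℤ^d} f(x-Lz)` and any `j ≥ 1`, with the cyclic
convention `y_{j+1} = y_1`,
`∫_{Λ^j} ∏_{i=1}^j f_Λ(y_i - y_{i+1}) dy = |Λ| ∑_{z∈ℤ^d} f^{*j}(Lz)`. -/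
theorem statement5
    (d : ℕ) (hd : 1 ≤ d) (f : Eu d → ℝ)
    (hf_meas : Measurable f) (hf_nonneg : ∀ x, 0 ≤ f x) (hf_int : Integrable f)
    (L : ℝ) (hL : 0 < L) (j : ℕ) (hj : 1 ≤ j) :
    ∫⁻ y in Set.univ.pi (fun _ : Fin j => cube d L),
        ∏ i : Fin j, fper d f L (y i - y (finRotate j i)) =
      ENNReal.ofReal (L ^ d) *
        ∑' z : Fin d → ℤ, iterConv d (fun x => ENNReal.ofReal (f x)) (j - 1) (latPt d L z) := by
  obtain ⟨n, rfl⟩ : ∃ n, j = n + 1 := ⟨j - 1, by omega⟩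
  have hF : Measurable fun x => ENNReal.ofReal (f x) := hf_meas.ennreal_ofReal
  have hP := measurable_periodization L hF
  change ∫⁻ y in _, ∏ i, periodization d L (fun x => ENNReal.ofReal (f x)) _ = _
  rw [volume_pi, Measure.restrict_pi_pi, lintegral_pi_insertNth _ 0]
  · simp only [Fin.insertNth_zero', cons_finRotate, lintegral_path_periodization hL hF, sub_self,
      periodization_zero, lintegral_const, Measure.restrict_apply_univ, volume_cube d hL]
    rw [mul_comm, Nat.add_sub_cancel]
  · exact Finset.measurable_prod _ fun i _ =>
      hP.comp ((measurable_pi_apply i).sub (measurable_pi_apply _))
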